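/- Let G be a finite simple 3-regular bipartite graph on exactly 2h+8 vertices (h a natural number) having exactly six cycles of length 4, any two distinct 4-cycles of G sharing at most one edge. Then the number of 4-matchings of G satisfies 8·M(G,4) = 27h⁴ + 162h³ + 273h² + 234h + 72 (i.e. M(G,4) = (27/8)h⁴ + (81/4)h³ + (273/8)h² + (117/4)h + 9). -/

import Mathlib

open SimpleGraph

/-- The number of `k`-matchings of a graph `G`: `k`-element sets of pairwise disjoint
edges of `G`, identified with the matching subgraphs of `G` having exactly `k` edges. -/
noncomputable def numMatchings {V : Type*} (G : SimpleGraph V) (k : ℕ) : ℕ :=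
  Set.ncard {H : G.Subgraph | H.IsMatching ∧ H.edgeSet.ncard = k}

/-- The number of subgraphs of `G` isomorphic to the graph `X`. -/
noncomputable def numSubgraphs {V W : Type*} (G : SimpleGraph V) (X : SimpleGraph W) : ℕ :=
  Set.ncard {H : G.Subgraph | Nonempty (H.coe ≃g X)}

/-- Two edges are vertex-disjoint. -/
def VertexDisjoint {V : Type*} (e f : Sym2 V) : Prop := ∀ v ∈ e, v ∉ f

theorem VertexDisjoint.symm {V : Type*} {e f : Sym2 V} (hef : VertexDisjoint e f) :
    VertexDisjoint f e := fun v hf he => hef v he hf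

theorem vertexDisjoint_comm {V : Type*} {e f : Sym2 V} :
    VertexDisjoint e f ↔ VertexDisjoint f e := ⟨VertexDisjoint.symm, VertexDisjoint.symm⟩

theorem VertexDisjoint.ne {V : Type*} {e f : Sym2 V} (hef : VertexDisjoint e f) : e ≠ f := by
  rintro rfl
  induction e with | h x y => exact hef x (Sym2.mem_mk_left x y) (Sym2.mem_mk_left x y)

open Classical in
/-- The matchings of `G` with `k` edges, as sets of edges. -/
noncomputable def matchingEdgeFinsets {V : Type*} [Fintype V] (G : SimpleGraph V) (k : ℕ) :
    Finset (Finset (Sym2 V)) :=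
  {S | (∀ e ∈ S, e ∈ G.edgeSet) ∧ S.card = k ∧ (S : Set (Sym2 V)).Pairwise VertexDisjoint}

theorem mem_matchingEdgeFinsets {V : Type*} [Fintype V] {G : SimpleGraph V} {k : ℕ}
    {S : Finset (Sym2 V)} : S ∈ matchingEdgeFinsets G k ↔ (∀ e ∈ S, e ∈ G.edgeSet) ∧
      S.card = k ∧ (S : Set (Sym2 V)).Pairwise VertexDisjoint := by
  simp [matchingEdgeFinsets]

theorem numMatchings_eq_card_matchingEdgeFinsets {V : Type*} [Fintype V] (G : SimpleGraph V)
    (k : ℕ) : numMatchings G k = (matchingEdgeFinsets G k).card := by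
  classical
  rw [numMatchings, ← Set.ncard_coe_finset]
  refine Set.ncard_congr (fun H _ => H.edgeSet.toFinset) ?_ ?_ ?_
  · rintro H ⟨hH, hk⟩
    rw [Finset.mem_coe, mem_matchingEdgeFinsets]
    refine ⟨fun e he => H.edgeSet_subset (by simpa using he), ?_, ?_⟩
    · rw [← hk, Set.ncard_eq_toFinset_card']
    · intro e he f hf hef v hve hvf
      obtain ⟨x, rfl⟩ := hve
      obtain ⟨y, rfl⟩ := hvf
      simp only [Set.coe_toFinset, Subgraph.mem_edgeSet] at he hf
      exact hef (by rw [hH.eq_of_adj_left he hf])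
  · intro H K hH hK heq
    exact Subgraph.IsMatching.injOn_edgeSet hH.1 hK.1 (Set.toFinset_inj.1 heq)
  · intro S hS
    rw [Finset.mem_coe, mem_matchingEdgeFinsets] at hS
    obtain ⟨hG, hk, hd⟩ := hS
    let H : G.Subgraph :=
      { verts := {v | ∃ w, s(v, w) ∈ S}
        Adj := fun v w => s(v, w) ∈ S
        adj_sub := fun {v w} hvw => hG _ hvw
        edge_vert := fun {v w} hvw => ⟨w, hvw⟩
        symm := ⟨fun v w hvw => by rwa [Sym2.eq_swap]⟩ }
    have hHS : H.edgeSet = (S : Set (Sym2 V)) := by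
      ext e
      induction e with | h x y => rfl
    refine ⟨H, ⟨?_, by rw [hHS, Set.ncard_coe_finset, hk]⟩, ?_⟩
    · rintro v ⟨w, hw⟩
      refine ⟨w, hw, fun y hy => ?_⟩
      by_contra hne
      exact hd hy hw (fun heq => hne (Sym2.congr_right.1 heq)) v
        (Sym2.mem_mk_left v y) (Sym2.mem_mk_left v w)
    · ext e
      simp [hHS]

theorem injective_of_card_image_univ {α : Type*} [DecidableEq α] {k : ℕ} {f : Fin k → α}
    (hf : (Finset.univ.image f).card = k) : Function.Injective f := by
  rw [← Set.injOn_univ, ← Finset.coe_univ, ← Finset.card_image_iff, hf, Finset.card_fin]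

theorem card_filter_image_eq {α : Type*} [Fintype α] [DecidableEq α] {k : ℕ} {S : Finset α}
    (hS : S.card = k) :
    Finset.card {f : Fin k → α | Finset.univ.image f = S} = k.factorial := by
  have hcard : Fintype.card (Fin k ↪ S) = k.factorial := by
    rw [Fintype.card_embedding_eq, Fintype.card_coe, Fintype.card_fin, hS, Nat.descFactorial_self]
  rw [← hcard, ← Finset.card_univ]
  symm
  refine Finset.card_bij (fun g _ i => (g i : α)) ?_ ?_ ?_
  · intro g _
    rw [Finset.mem_filter]
    refine ⟨Finset.mem_univ _, Finset.eq_of_subset_of_card_le ?_ ?_⟩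
    · intro x hx
      obtain ⟨i, -, rfl⟩ := Finset.mem_image.1 hx
      exact (g i).2
    · rw [Finset.card_image_of_injective Finset.univ (f := fun i => (g i : α))
        (Subtype.val_injective.comp g.injective), hS, Finset.card_fin]
  · intro g _ g' _ hgg
    ext i
    exact congrFun hgg i
  · intro f hf
    have hf' := (Finset.mem_filter.1 hf).2
    have hinj := injective_of_card_image_univ (hf'.symm ▸ hS)
    refine ⟨⟨fun i => ⟨f i, hf' ▸ Finset.mem_image_of_mem f (Finset.mem_univ i)⟩,
      fun i j hij => hinj (congrArg Subtype.val hij)⟩, Finset.mem_univ _, rfl⟩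

open Classical in
/-- The `k`-tuples of pairwise vertex-disjoint darts of `G`. -/
noncomputable def dartMatchings {V : Type*} [Fintype V] (G : SimpleGraph V) [DecidableRel G.Adj]
    (k : ℕ) : Finset (Fin k → G.Dart) :=
  {g | Pairwise fun i j => VertexDisjoint (g i).edge (g j).edge}

open Classical in
/-- The `k`-tuples of pairwise vertex-disjoint edges of `G`. -/
noncomputable def edgeMatchings {V : Type*} [Fintype V] (G : SimpleGraph V) (k : ℕ) :
    Finset (Fin k → Sym2 V) :=
  {f | (∀ i, f i ∈ G.edgeSet) ∧ Pairwise fun i j => VertexDisjoint (f i) (f j)}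

theorem card_edgeMatchings {V : Type*} [Fintype V] (G : SimpleGraph V) (k : ℕ) :
    (edgeMatchings G k).card = numMatchings G k * k.factorial := by
  classical
  rw [numMatchings_eq_card_matchingEdgeFinsets,
    Finset.card_eq_sum_card_fiberwise (t := matchingEdgeFinsets G k)
      (f := fun f => Finset.univ.image f)]
  · rw [Finset.sum_congr rfl (g := fun _ => k.factorial), Finset.sum_const, smul_eq_mul]
    intro S hS
    rw [mem_matchingEdgeFinsets] at hS
    obtain ⟨hG, hk, hd⟩ := hS
    rw [← card_filter_image_eq hk]
    congr 1
    ext f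
    simp only [edgeMatchings, Finset.mem_filter, Finset.mem_univ, true_and, and_iff_right_iff_imp]
    rintro rfl
    have hmem : ∀ i, f i ∈ Finset.univ.image f := fun i =>
      Finset.mem_image_of_mem f (Finset.mem_univ i)
    have hinj := injective_of_card_image_univ hk
    exact ⟨fun i => hG _ (hmem i), fun i j hij => hd (hmem i) (hmem j) (hinj.ne hij)⟩
  · intro f hf
    simp only [edgeMatchings, Finset.coe_filter, Finset.mem_univ, true_and, Set.mem_ofPred_eq] at hf
    rw [Finset.mem_coe, mem_matchingEdgeFinsets]
    have hinj : Function.Injective f := fun i j hij => by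
      by_contra hne
      exact (hf.2 hne).ne hij
    refine ⟨?_, ?_, ?_⟩
    · intro e he
      obtain ⟨i, -, rfl⟩ := Finset.mem_image.1 he
      exact hf.1 i
    · simp [Finset.card_image_of_injective _ hinj]
    · intro e he e' he' hne
      obtain ⟨i, -, rfl⟩ := Finset.mem_image.1 (Finset.mem_coe.1 he)
      obtain ⟨j, -, rfl⟩ := Finset.mem_image.1 (Finset.mem_coe.1 he')
      exact hf.2 fun hij => hne (congrArg f hij)

theorem card_dartMatchings {V : Type*} [Fintype V] (G : SimpleGraph V) [DecidableRel G.Adj]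
    (k : ℕ) : (dartMatchings G k).card = numMatchings G k * (k.factorial * 2 ^ k) := by
  classical
  rw [← mul_assoc, ← card_edgeMatchings,
    Finset.card_eq_sum_card_fiberwise (t := edgeMatchings G k) (f := fun g i => (g i).edge)]
  · rw [Finset.sum_congr rfl (g := fun _ => 2 ^ k), Finset.sum_const, smul_eq_mul]
    intro f hf
    simp only [edgeMatchings, Finset.mem_filter, Finset.mem_univ, true_and] at hf
    have hcard := Fintype.card_piFinset fun i => ({d : G.Dart | d.edge = f i} : Finset G.Dart)
    simp only [fun i => G.dart_edge_fiber_card (f i) (hf.1 i), Finset.prod_const,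
      Finset.card_univ, Fintype.card_fin] at hcard
    rw [← hcard]
    congr 1
    ext g
    simp only [dartMatchings, Finset.mem_filter, Finset.mem_univ, true_and, Fintype.mem_piFinset,
      funext_iff, and_iff_right_iff_imp]
    intro hg i j hij
    simpa only [hg] using hf.2 hij
  · intro g hg
    simp only [dartMatchings, Finset.coe_filter, Finset.mem_univ, true_and,
      Set.mem_ofPred_eq] at hg
    simpa [edgeMatchings] using hg

theorem natCard_copy_eq_numSubgraphs_mul {V W : Type*} [Finite V] [Finite W] (G : SimpleGraph V)
    (X : SimpleGraph W) : Nat.card (X.Copy G) = numSubgraphs G X * Nat.card (X ≃g X) := by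
  classical
  have := Fintype.ofFinite V
  have := Fintype.ofFinite W
  let F : (Σ H : {H : G.Subgraph // Nonempty (H.coe ≃g X)}, X ≃g H.1.coe) → X.Copy G :=
    fun p => p.1.1.coeCopy.comp p.2.toCopy
  have hF : ∀ p, (F p).toSubgraph = p.1.1 := by
    rintro ⟨⟨H, hH⟩, e⟩
    ext x y
    · simp only [Copy.toSubgraph, Subgraph.map_verts, Subgraph.verts_top, Set.image_univ,
        Set.mem_range]
      exact ⟨fun ⟨w, hw⟩ => hw ▸ (e w).2, fun hx => ⟨e.symm ⟨x, hx⟩, 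
        congrArg Subtype.val (e.apply_symm_apply _)⟩⟩
    · simp only [Copy.toSubgraph, Subgraph.map_adj, Relation.Map]
      constructor
      · rintro ⟨v, w, hvw, rfl, rfl⟩
        exact e.map_adj_iff.2 hvw
      · intro hxy
        exact ⟨e.symm ⟨x, H.edge_vert hxy⟩, e.symm ⟨y, H.edge_vert hxy.symm⟩,
          e.symm.map_adj_iff.2 hxy, congrArg Subtype.val (e.apply_symm_apply _),
          congrArg Subtype.val (e.apply_symm_apply _)⟩
  have : ∀ p : {H : G.Subgraph // Nonempty (H.coe ≃g X)}, Finite (X ≃g p.1.coe) :=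
    fun p => DFunLike.finite _
  have hbij : Function.Bijective F := by
    constructor
    · rintro ⟨⟨H, hH⟩, e⟩ ⟨⟨K, hK⟩, e'⟩ heq
      obtain rfl : H = K := by simpa [hF] using congrArg Copy.toSubgraph heq
      congr 1
      ext w
      exact congrArg (fun f : X.Copy G => f w) heq
    · intro f
      refine ⟨⟨⟨f.toSubgraph, ⟨f.isoToSubgraph.symm⟩⟩, f.isoToSubgraph⟩, ?_⟩
      ext w
      rfl
  rw [← Nat.card_congr (Equiv.ofBijective F hbij), Nat.card_sigma,
    Finset.sum_congr rfl (g := fun _ => Nat.card (X ≃g X)), Finset.sum_const, smul_eq_mul,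
    numSubgraphs, ← Nat.card_coe_set_eq, Finset.card_univ, ← Nat.card_eq_fintype_card]
  · rfl
  · rintro ⟨H, ⟨e⟩⟩ -
    exact Nat.card_congr ⟨fun f => f.trans e, fun f => f.trans e.symm,
      fun f => by ext; simp, fun f => by ext; simp⟩

theorem natCard_cycleGraph_four_iso : Nat.card (cycleGraph 4 ≃g cycleGraph 4) = 8 := by
  let E : (cycleGraph 4 ≃g cycleGraph 4) ≃
      {σ : Equiv.Perm (Fin 4) // ∀ i j, (σ j - σ i = 1 ∨ σ i - σ j = 1) ↔ (j - i = 1 ∨ i - j = 1)} :=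
    { toFun := fun f => ⟨f.toEquiv, fun i j => by
        have := f.map_adj_iff (v := j) (w := i)
        simpa [cycleGraph_adj] using this⟩
      invFun := fun σ => ⟨σ.1, fun {j i} => by simpa [cycleGraph_adj] using σ.2 i j⟩
      left_inv := fun f => rfl
      right_inv := fun σ => rfl }
  rw [Nat.card_congr E, Nat.card_eq_fintype_card]
  decide

/-- Labelled 4-cycles, as pairs of disjoint darts with adjacent tails and adjacent heads. -/
def squareDartPairs {V : Type*} (G : SimpleGraph V) : Set (G.Dart × G.Dart) :=
  {p | VertexDisjoint p.1.edge p.2.edge ∧ G.Adj p.1.fst p.2.fst ∧ G.Adj p.1.snd p.2.snd}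

theorem ncard_squareDartPairs {V : Type*} [Finite V] (G : SimpleGraph V) :
    (squareDartPairs G).ncard = 8 * numSubgraphs G (cycleGraph 4) := by
  classical
  rw [mul_comm, ← natCard_cycleGraph_four_iso, ← natCard_copy_eq_numSubgraphs_mul,
    ← Set.ncard_univ]
  symm
  have hadj : ∀ i j : Fin 4, i - j = 1 ∨ j - i = 1 → (cycleGraph 4).Adj i j := fun i j hij =>
    cycleGraph_adj.2 hij
  refine Set.ncard_congr (fun f _ =>
    (⟨(f 0, f 1), f.toHom.map_adj (hadj 0 1 (by decide))⟩,
      ⟨(f 3, f 2), f.toHom.map_adj (hadj 3 2 (by decide))⟩)) ?_ ?_ ?_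
  · intro f _
    refine ⟨?_, f.toHom.map_adj (hadj 0 3 (by decide)), f.toHom.map_adj (hadj 1 2 (by decide))⟩
    have hne : ∀ i j, i ≠ j → f i ≠ f j := fun i j => f.injective.ne
    intro v
    simp only [Dart.edge_mk, Sym2.mem_iff]
    rintro (rfl | rfl) <;> simp [hne]
  · intro f g _ _ hfg
    simp only [Prod.mk.injEq, Dart.mk.injEq] at hfg
    ext i
    fin_cases i
    exacts [hfg.1.1, hfg.1.2, hfg.2.2, hfg.2.1]
  · rintro ⟨⟨⟨a, b⟩, hab⟩, ⟨⟨d, c⟩, hdc⟩⟩ ⟨hdis, had, hbc⟩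
    simp only [VertexDisjoint, Dart.edge_mk, Sym2.mem_iff, forall_eq_or_imp, forall_eq,
      not_or] at hdis hab hdc had hbc
    have hab' := hab.ne
    have hdc' := hdc.ne
    refine ⟨⟨⟨![a, b, c, d], ?_⟩, ?_⟩, trivial, rfl⟩
    · intro i j hij
      rw [cycleGraph_adj] at hij
      revert hij
      fin_cases i <;> fin_cases j <;>
        simp [hab, hab.symm, hdc, hdc.symm, had, had.symm, hbc, hbc.symm] <;>
        exact fun hij => absurd hij (by decide)
    · intro i j
      fin_cases i <;> fin_cases j <;> simp <;> grind

section DartSums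

variable {V : Type*} {G : SimpleGraph V}

open Classical in
/-- The indicator of adjacency. -/
noncomputable def adjInd (G : SimpleGraph V) (x y : V) : ℤ := if G.Adj x y then 1 else 0

open Classical in
/-- The indicator of `x` being an end of the dart `d`. -/
noncomputable def endInd (d : G.Dart) (x : V) : ℤ := if x ∈ d.edge then 1 else 0

open Classical in
/-- The indicator of two darts being vertex-disjoint. -/
noncomputable def disjInd (d e : G.Dart) : ℤ := if VertexDisjoint d.edge e.edge then 1 else 0

/-- The number of edges of `G` joining an end of `d` to an end of `e`, for disjoint `d`, `e`. -/
noncomputable def links (d e : G.Dart) : ℤ :=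
  adjInd G d.fst e.fst + adjInd G d.fst e.snd + adjInd G d.snd e.fst + adjInd G d.snd e.snd

theorem adjInd_comm (x y : V) : adjInd G x y = adjInd G y x := by
  classical exact if_congr (G.adj_comm x y) rfl rfl

theorem links_comm (d e : G.Dart) : links d e = links e d := by
  simp only [links, adjInd_comm (G := G) d.fst, adjInd_comm (G := G) d.snd]
  ring

theorem disjInd_comm (d e : G.Dart) : disjInd d e = disjInd e d := by
  classical exact if_congr vertexDisjoint_comm rfl rfl

theorem disjInd_eq (d e : G.Dart) :
    disjInd d e = (1 - endInd d e.fst) * (1 - endInd d e.snd) := by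
  have hiff : VertexDisjoint d.edge e.edge ↔ e.fst ∉ d.edge ∧ e.snd ∉ d.edge := by
    rw [vertexDisjoint_comm]
    simp [VertexDisjoint, Dart.edge]
  by_cases h₁ : e.fst ∈ d.edge <;> by_cases h₂ : e.snd ∈ d.edge <;>
    simp [disjInd, endInd, hiff, h₁, h₂]

theorem endInd_mul_endInd {d e : G.Dart} (hde : VertexDisjoint d.edge e.edge) (x : V) :
    endInd d x * endInd e x = 0 := by
  by_cases hx : x ∈ d.edge
  · simp [endInd, hde x hx]
  · simp [endInd, hx]

theorem links_self (d : G.Dart) : links d d = 2 := by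
  simp [links, adjInd, d.adj, d.adj.symm]

theorem one_sub_disjInd_mul_mul {d e f : G.Dart} (hde : VertexDisjoint d.edge e.edge)
    (hdf : VertexDisjoint d.edge f.edge) (hef : VertexDisjoint e.edge f.edge) (a : G.Dart) :
    (1 - disjInd d a) * (1 - disjInd e a) * (1 - disjInd f a) = 0 := by
  have h₁ := endInd_mul_endInd hde a.fst
  have h₂ := endInd_mul_endInd hde a.snd
  have h₃ := endInd_mul_endInd hdf a.fst
  have h₄ := endInd_mul_endInd hdf a.snd
  have h₅ := endInd_mul_endInd hef a.fst
  have h₆ := endInd_mul_endInd hef a.snd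
  simp only [disjInd_eq]
  grind

theorem adjInd_mul_adjInd_of_triangleFree (htri : ∀ x y z, G.Adj x y → G.Adj y z → ¬ G.Adj x z)
    (x : V) (d : G.Dart) : adjInd G x d.fst * adjInd G x d.snd = 0 := by
  by_cases hx : G.Adj x d.fst
  · simp [adjInd, htri x d.fst d.snd hx d.adj]
  · simp [adjInd, hx]

theorem disjInd_symm_right (d e : G.Dart) : disjInd d e.symm = disjInd d e := by
  classical exact if_congr (by rw [Dart.edge_symm]) rfl rfl

theorem disjInd_symm_left (d e : G.Dart) : disjInd d.symm e = disjInd d e := by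
  classical exact if_congr (by rw [Dart.edge_symm]) rfl rfl

variable [Fintype V]

theorem sum_endInd_mul (d : G.Dart) (g : V → ℤ) :
    ∑ x, endInd d x * g x = g d.fst + g d.snd := by
  classical
  have hpt : ∀ x, endInd d x * g x =
      (if d.fst = x then g x else 0) + (if d.snd = x then g x else 0) := by
    intro x
    have hne := d.fst_ne_snd
    simp only [endInd, Dart.edge, Sym2.mem_iff]
    grind
  simp only [hpt, Finset.sum_add_distrib, Finset.sum_ite_eq, Finset.mem_univ, if_true]

theorem sum_endInd (d : G.Dart) : ∑ x, endInd d x = 2 := by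
  simpa using sum_endInd_mul d fun _ => 1

variable [DecidableRel G.Adj]

theorem sum_dart_symm (f : G.Dart → ℤ) : ∑ d : G.Dart, f d.symm = ∑ d, f d :=
  Equiv.sum_comp (Dart.symm_involutive (G := G)).toPerm f

theorem sum_dart (f : V → V → ℤ) :
    ∑ d : G.Dart, f d.fst d.snd = ∑ x, ∑ y, adjInd G x y * f x y := by
  classical
  rw [← Fintype.sum_prod_type' (f := fun x y => adjInd G x y * f x y)]
  simp only [adjInd, ite_mul, one_mul, zero_mul]
  rw [← Finset.sum_filter]
  refine Finset.sum_bij (fun d _ => d.toProd) ?_ ?_ ?_ ?_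
  · intro d _
    simp [d.adj]
  · intro d _ e _ hde
    exact Dart.ext _ _ hde
  · intro p hp
    exact ⟨⟨p, (Finset.mem_filter.1 hp).2⟩, Finset.mem_univ _, rfl⟩
  · intro d _
    rfl

theorem sum_adjInd (hreg : G.IsRegularOfDegree 3) (x : V) : ∑ y, adjInd G x y = 3 := by
  have hdeg := hreg x
  rw [← card_neighborFinset_eq_degree, neighborFinset_eq_filter, Finset.card_filter] at hdeg
  have hpt : ∀ y, adjInd G x y = ((if G.Adj x y then 1 else 0 : ℕ) : ℤ) := fun y => by
    by_cases hy : G.Adj x y <;> simp [adjInd, hy]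
  simp only [hpt, ← Nat.cast_sum, hdeg]
  rfl

theorem sum_dart_fst (hreg : G.IsRegularOfDegree 3) (g : V → ℤ) :
    ∑ d : G.Dart, g d.fst = 3 * ∑ x, g x := by
  rw [sum_dart fun x _ => g x, Finset.mul_sum]
  simp only [← Finset.sum_mul, sum_adjInd hreg]

theorem sum_dart_snd (hreg : G.IsRegularOfDegree 3) (g : V → ℤ) :
    ∑ d : G.Dart, g d.snd = 3 * ∑ x, g x := by
  rw [← sum_dart_fst hreg, ← sum_dart_symm]
  rfl

theorem sum_endInd_mul_endInd (d e : G.Dart) :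
    ∑ a : G.Dart, endInd d a.fst * endInd e a.snd = links d e := by
  rw [sum_dart fun x y => endInd d x * endInd e y]
  have hpt : ∀ x, ∑ y, adjInd G x y * (endInd d x * endInd e y) =
      endInd d x * ∑ y, endInd e y * adjInd G x y := fun x => by
    rw [Finset.mul_sum]
    exact Finset.sum_congr rfl fun y _ => by ring
  simp only [hpt, sum_endInd_mul, links]
  ring

theorem sum_one_sub_disjInd (hreg : G.IsRegularOfDegree 3) (d : G.Dart) :
    ∑ a, (1 - disjInd d a) = 10 := by
  have hpt : ∀ a : G.Dart, 1 - disjInd d a =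
      endInd d a.fst + endInd d a.snd - endInd d a.fst * endInd d a.snd := fun a => by
    rw [disjInd_eq]
    ring
  simp only [hpt, Finset.sum_sub_distrib, Finset.sum_add_distrib, sum_endInd_mul_endInd,
    sum_dart_fst hreg, sum_dart_snd hreg, sum_endInd, links_self]
  norm_num

theorem sum_one_sub_disjInd_mul {d e : G.Dart} (hde : VertexDisjoint d.edge e.edge) :
    ∑ a, (1 - disjInd d a) * (1 - disjInd e a) = 2 * links d e := by
  have hpt : ∀ a : G.Dart, (1 - disjInd d a) * (1 - disjInd e a) =
      endInd d a.fst * endInd e a.snd + endInd e a.fst * endInd d a.snd := fun a => by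
    have h₁ := endInd_mul_endInd hde a.fst
    have h₂ := endInd_mul_endInd hde a.snd
    simp only [disjInd_eq]
    linear_combination (1 - endInd d a.snd - endInd e a.snd + endInd d a.snd * endInd e a.snd)
      * h₁ + (1 - endInd d a.fst - endInd e a.fst) * h₂
  simp only [hpt, Finset.sum_add_distrib, sum_endInd_mul_endInd, links_comm e d]
  ring

theorem sum_disjInd (hreg : G.IsRegularOfDegree 3) (d : G.Dart) :
    ∑ a, disjInd d a = Fintype.card G.Dart - 10 := by
  have hsum := sum_one_sub_disjInd hreg d
  simp only [Finset.sum_sub_distrib, Finset.sum_const, Finset.card_univ, nsmul_eq_mul,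
    mul_one] at hsum
  linarith

theorem sum_disjInd_mul (hreg : G.IsRegularOfDegree 3) {d e : G.Dart}
    (hde : VertexDisjoint d.edge e.edge) :
    ∑ a, disjInd d a * disjInd e a = Fintype.card G.Dart - 20 + 2 * links d e := by
  have hpt : ∀ a : G.Dart, disjInd d a * disjInd e a =
      (1 - disjInd d a) * (1 - disjInd e a) + disjInd d a + disjInd e a - 1 := fun a => by ring
  simp only [hpt, Finset.sum_sub_distrib, Finset.sum_add_distrib, sum_one_sub_disjInd_mul hde,
    sum_disjInd hreg, Finset.sum_const, Finset.card_univ, nsmul_eq_mul, mul_one]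
  ring

theorem sum_disjInd_mul_mul (hreg : G.IsRegularOfDegree 3) {d e f : G.Dart}
    (hde : VertexDisjoint d.edge e.edge) (hdf : VertexDisjoint d.edge f.edge)
    (hef : VertexDisjoint e.edge f.edge) :
    ∑ a, disjInd d a * disjInd e a * disjInd f a =
      Fintype.card G.Dart - 30 + 2 * (links d e + links d f + links e f) := by
  have hpt : ∀ a : G.Dart, disjInd d a * disjInd e a * disjInd f a =
      disjInd d a * disjInd e a + disjInd d a * disjInd f a + disjInd e a * disjInd f a
        - disjInd d a - disjInd e a - disjInd f a + 1 := fun a => by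
    linear_combination -one_sub_disjInd_mul_mul hde hdf hef a
  simp only [hpt, Finset.sum_sub_distrib, Finset.sum_add_distrib, sum_disjInd hreg,
    sum_disjInd_mul hreg hde, sum_disjInd_mul hreg hdf, sum_disjInd_mul hreg hef,
    Finset.sum_const, Finset.card_univ, nsmul_eq_mul, mul_one]
  ring

theorem card_dartMatchings_four : ((dartMatchings G 4).card : ℤ) =
    ∑ d : G.Dart, ∑ e, ∑ f, disjInd d e * disjInd d f * disjInd e f *
      ∑ a, disjInd d a * disjInd e a * disjInd f a := by
  classical
  let E : (Fin 4 → G.Dart) ≃ G.Dart × G.Dart × G.Dart × G.Dart :=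
    { toFun := fun g => (g 0, g 1, g 2, g 3)
      invFun := fun p => ![p.1, p.2.1, p.2.2.1, p.2.2.2]
      left_inv := fun g => by ext i : 1; fin_cases i <;> rfl
      right_inv := fun p => rfl }
  have hprod : ∀ p q : Prop, ∀ [Decidable p] [Decidable q],
      ((if p then 1 else 0) * if q then 1 else 0 : ℤ) = if p ∧ q then 1 else 0 := by
    intro p q _ _
    by_cases p <;> by_cases q <;> simp [*]
  rw [dartMatchings, Finset.card_filter, Nat.cast_sum]
  simp only [Finset.mul_sum]
  rw [← E.symm.sum_comp]
  simp only [Fintype.sum_prod_type]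
  refine Finset.sum_congr rfl fun d _ => Finset.sum_congr rfl fun e _ =>
    Finset.sum_congr rfl fun f _ => Finset.sum_congr rfl fun a _ => ?_
  simp only [disjInd, hprod]
  rw [Nat.cast_ite, Nat.cast_one, Nat.cast_zero]
  refine if_congr ?_ rfl rfl
  constructor
  · intro hp
    exact ⟨⟨⟨hp (i := 0) (j := 1) (by decide), hp (i := 0) (j := 2) (by decide)⟩,
      hp (i := 1) (j := 2) (by decide)⟩, ⟨hp (i := 0) (j := 3) (by decide),
      hp (i := 1) (j := 3) (by decide)⟩, hp (i := 2) (j := 3) (by decide)⟩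
  · rintro ⟨⟨⟨hde, hdf⟩, hef⟩, ⟨hda, hea⟩, hfa⟩ i j hij
    fin_cases i <;> fin_cases j
    exacts [absurd rfl hij, hde, hdf, hda, hde.symm, absurd rfl hij, hef, hea, hdf.symm, hef.symm,
      absurd rfl hij, hfa, hda.symm, hea.symm, hfa.symm, absurd rfl hij]

theorem card_dartMatchings_four_eq (hreg : G.IsRegularOfDegree 3) :
    ((dartMatchings G 4).card : ℤ) =
      (Fintype.card G.Dart - 30) * ((Fintype.card G.Dart - 20) * (Fintype.card G.Dart *
        (Fintype.card G.Dart - 10)) + 2 * ∑ d : G.Dart, ∑ e, disjInd d e * links d e) +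
      6 * ((Fintype.card G.Dart - 20) * ∑ d : G.Dart, ∑ e, disjInd d e * links d e +
        2 * ∑ d : G.Dart, ∑ e, disjInd d e * links d e ^ 2) := by
  set t : ℤ := (Fintype.card G.Dart : ℤ) with ht
  have hpair : ∑ d : G.Dart, ∑ e, disjInd d e = t * (t - 10) := by
    simp only [sum_disjInd hreg, Finset.sum_const, Finset.card_univ, nsmul_eq_mul, ← ht]
  have hext : ∀ d e : G.Dart, ∑ f, disjInd d e * disjInd d f * disjInd e f =
      disjInd d e * (t - 20 + 2 * links d e) := by
    intro d e
    by_cases hde : VertexDisjoint d.edge e.edge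
    · rw [← sum_disjInd_mul hreg hde, Finset.mul_sum]
      exact Finset.sum_congr rfl fun f _ => by ring
    · simp [disjInd, hde]
  have hext' : ∀ d e f : G.Dart, disjInd d e * disjInd d f * disjInd e f *
      ∑ a, disjInd d a * disjInd e a * disjInd f a = disjInd d e * disjInd d f * disjInd e f *
        (t - 30 + 2 * (links d e + links d f + links e f)) := by
    intro d e f
    by_cases hde : VertexDisjoint d.edge e.edge
    · by_cases hdf : VertexDisjoint d.edge f.edge
      · by_cases hef : VertexDisjoint e.edge f.edge
        · rw [sum_disjInd_mul_mul hreg hde hdf hef]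
        · simp [disjInd, hef]
      · simp [disjInd, hdf]
    · simp [disjInd, hde]
  have htriple : ∑ d : G.Dart, ∑ e, ∑ f, disjInd d e * disjInd d f * disjInd e f =
      (t - 20) * (t * (t - 10)) + 2 * ∑ d : G.Dart, ∑ e, disjInd d e * links d e := by
    simp only [hext, ← hpair, Finset.mul_sum, ← Finset.sum_add_distrib]
    exact Finset.sum_congr rfl fun d _ => Finset.sum_congr rfl fun e _ => by ring
  have hlink₁ : ∑ d : G.Dart, ∑ e, ∑ f, disjInd d e * disjInd d f * disjInd e f * links d e =
      (t - 20) * ∑ d : G.Dart, ∑ e, disjInd d e * links d e +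
        2 * ∑ d : G.Dart, ∑ e, disjInd d e * links d e ^ 2 := by
    simp only [← Finset.sum_mul, hext, Finset.mul_sum, ← Finset.sum_add_distrib]
    exact Finset.sum_congr rfl fun d _ => Finset.sum_congr rfl fun e _ => by ring
  have hlink₂ : ∑ d : G.Dart, ∑ e, ∑ f, disjInd d e * disjInd d f * disjInd e f * links d f =
      ∑ d : G.Dart, ∑ e, ∑ f, disjInd d e * disjInd d f * disjInd e f * links d e := by
    refine Finset.sum_congr rfl fun d _ => ?_
    rw [Finset.sum_comm]
    refine Finset.sum_congr rfl fun e _ => Finset.sum_congr rfl fun f _ => ?_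
    rw [disjInd_comm f e]
    ring
  have hlink₃ : ∑ d : G.Dart, ∑ e, ∑ f, disjInd d e * disjInd d f * disjInd e f * links e f =
      ∑ d : G.Dart, ∑ e, ∑ f, disjInd d e * disjInd d f * disjInd e f * links d f := by
    rw [Finset.sum_comm]
    refine Finset.sum_congr rfl fun d _ => Finset.sum_congr rfl fun e _ =>
      Finset.sum_congr rfl fun f _ => ?_
    rw [disjInd_comm e d]
    ring
  have hsplit : ∀ d e f : G.Dart, disjInd d e * disjInd d f * disjInd e f *
        (t - 30 + 2 * (links d e + links d f + links e f)) =
      (t - 30) * (disjInd d e * disjInd d f * disjInd e f) +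
      2 * (disjInd d e * disjInd d f * disjInd e f * links d e) +
      2 * (disjInd d e * disjInd d f * disjInd e f * links d f) +
      2 * (disjInd d e * disjInd d f * disjInd e f * links e f) := fun d e f => by ring
  rw [card_dartMatchings_four]
  simp only [hext', hsplit, Finset.sum_add_distrib, ← Finset.mul_sum]
  rw [hlink₃, hlink₂, hlink₁, htriple]
  ring

theorem sum_sum_symm_right (f : G.Dart → G.Dart → ℤ) :
    ∑ d, ∑ e, f d (Dart.symm e) = ∑ d, ∑ e, f d e :=
  Finset.sum_congr rfl fun d _ => sum_dart_symm (f d)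

theorem sum_disjInd_mul_adjInd (hreg : G.IsRegularOfDegree 3)
    (htri : ∀ x y z, G.Adj x y → G.Adj y z → ¬ G.Adj x z) :
    ∑ d : G.Dart, ∑ e : G.Dart, disjInd d e * adjInd G d.fst e.fst =
      4 * Fintype.card G.Dart := by
  classical
  have hpt : ∀ d e : G.Dart, disjInd d e * adjInd G d.fst e.fst =
      adjInd G d.fst e.fst * (if d.snd = e.fst then 0 else 1) *
        (if e.snd = d.fst then 0 else 1) := by
    intro d e
    by_cases hde : G.Adj d.fst e.fst
    · have h₁ := hde.ne
      have h₂ : d.snd ≠ e.snd := fun heq => htri _ _ _ hde e.adj (heq ▸ d.adj)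
      by_cases h₃ : d.snd = e.fst
      · simp [disjInd, VertexDisjoint, Dart.edge, adjInd, hde, h₁, h₃]
      · by_cases h₄ : e.snd = d.fst
        · simp [disjInd, VertexDisjoint, Dart.edge, adjInd, hde, h₁, h₃, h₄]
        · simp [disjInd, VertexDisjoint, Dart.edge, adjInd, hde, h₁, h₂, h₃, h₄, Ne.symm h₄]
    · simp [adjInd, hde]
  have htwo : ∀ a : G.Dart, ∑ y, adjInd G a.fst y * (if y = a.snd then 0 else 1) = 2 := by
    intro a
    have hy : ∀ y, adjInd G a.fst y * (if y = a.snd then 0 else 1) =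
        adjInd G a.fst y - if y = a.snd then adjInd G a.fst y else 0 := fun y => by
      by_cases hya : y = a.snd <;> simp [hya]
    simp only [hy, Finset.sum_sub_distrib, sum_adjInd hreg, Finset.sum_ite_eq', Finset.mem_univ,
      if_true]
    simp [adjInd, a.adj]
  calc ∑ d : G.Dart, ∑ e : G.Dart, disjInd d e * adjInd G d.fst e.fst
      = ∑ x, ∑ y, adjInd G x y * ∑ z, ∑ w, adjInd G z w * (adjInd G x z *
          (if y = z then 0 else 1) * (if w = x then 0 else 1)) := by
        rw [← sum_dart fun x y => ∑ z, ∑ w, adjInd G z w * (adjInd G x z *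
          (if y = z then 0 else 1) * (if w = x then 0 else 1))]
        refine Finset.sum_congr rfl fun d _ => ?_
        rw [← sum_dart fun z w => adjInd G d.fst z *
          (if d.snd = z then 0 else 1) * (if w = d.fst then 0 else 1)]
        simp only [hpt]
    _ = ∑ x, ∑ z, adjInd G x z * ((∑ y, adjInd G x y * (if y = z then 0 else 1)) *
          ∑ w, adjInd G z w * (if w = x then 0 else 1)) := by
        refine Finset.sum_congr rfl fun x _ => ?_
        refine (Finset.sum_congr rfl fun y _ => Finset.mul_sum ..).trans ?_
        rw [Finset.sum_comm]
        refine Finset.sum_congr rfl fun z _ => ?_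
        rw [Finset.sum_mul_sum, Finset.mul_sum]
        refine Finset.sum_congr rfl fun y _ => ?_
        rw [Finset.mul_sum, Finset.mul_sum]
        exact Finset.sum_congr rfl fun w _ => by ring
    _ = 4 * Fintype.card G.Dart := by
        rw [← sum_dart fun x z => (∑ y, adjInd G x y * (if y = z then 0 else 1)) *
          ∑ w, adjInd G z w * (if w = x then 0 else 1)]
        have hfour : ∀ a : G.Dart, (∑ y, adjInd G a.fst y * (if y = a.snd then 0 else 1)) *
            ∑ w, adjInd G a.snd w * (if w = a.fst then 0 else 1) = 4 := fun a => by
          rw [htwo a, show ∑ w, adjInd G a.snd w * (if w = a.fst then 0 else 1) = 2 from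
            htwo a.symm]
          norm_num
        simp only [hfour, Finset.sum_const, Finset.card_univ, nsmul_eq_mul]
        ring

theorem sum_disjInd_mul_links (hreg : G.IsRegularOfDegree 3)
    (htri : ∀ x y z, G.Adj x y → G.Adj y z → ¬ G.Adj x z) :
    ∑ d : G.Dart, ∑ e, disjInd d e * links d e = 16 * Fintype.card G.Dart := by
  have h₁ := sum_disjInd_mul_adjInd hreg htri
  have h₂ : ∑ d : G.Dart, ∑ e : G.Dart, disjInd d e * adjInd G d.fst e.snd =
      4 * Fintype.card G.Dart := by
    rw [← h₁, ← sum_sum_symm_right]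
    simp only [disjInd_symm_right]
    rfl
  have h₃ : ∑ d : G.Dart, ∑ e : G.Dart, disjInd d e * adjInd G d.snd e.fst =
      4 * Fintype.card G.Dart := by
    rw [← h₁, ← sum_dart_symm]
    simp only [disjInd_symm_left]
    rfl
  have h₄ : ∑ d : G.Dart, ∑ e : G.Dart, disjInd d e * adjInd G d.snd e.snd =
      4 * Fintype.card G.Dart := by
    rw [← h₂, ← sum_dart_symm]
    simp only [disjInd_symm_left]
    rfl
  simp only [links, mul_add, Finset.sum_add_distrib, h₁, h₂, h₃, h₄]
  ring

theorem sum_disjInd_mul_square :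
    ∑ d : G.Dart, ∑ e : G.Dart, disjInd d e * (adjInd G d.fst e.fst * adjInd G d.snd e.snd) =
      8 * numSubgraphs G (cycleGraph 4) := by
  classical
  have hcoe : squareDartPairs G =
      (Finset.univ.filter (· ∈ squareDartPairs G) : Finset (G.Dart × G.Dart)) := by
    simp
  have hcard := ncard_squareDartPairs G
  rw [hcoe, Set.ncard_coe_finset, Finset.card_filter] at hcard
  rw [← Fintype.sum_prod_type' (f := fun d e : G.Dart =>
    disjInd d e * (adjInd G d.fst e.fst * adjInd G d.snd e.snd))]
  have hpt : ∀ p : G.Dart × G.Dart,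
      disjInd p.1 p.2 * (adjInd G p.1.fst p.2.fst * adjInd G p.1.snd p.2.snd) =
        ((if p ∈ squareDartPairs G then 1 else 0 : ℕ) : ℤ) := by
    intro p
    by_cases h₁ : VertexDisjoint p.1.edge p.2.edge <;> by_cases h₂ : G.Adj p.1.fst p.2.fst <;>
      by_cases h₃ : G.Adj p.1.snd p.2.snd <;> simp [disjInd, adjInd, squareDartPairs, h₁, h₂, h₃]
  simp only [hpt, ← Nat.cast_sum, hcard]
  push_cast
  rfl

theorem sum_disjInd_mul_links_sq (hreg : G.IsRegularOfDegree 3)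
    (htri : ∀ x y z, G.Adj x y → G.Adj y z → ¬ G.Adj x z) :
    ∑ d : G.Dart, ∑ e, disjInd d e * links d e ^ 2 =
      16 * Fintype.card G.Dart + 32 * numSubgraphs G (cycleGraph 4) := by
  have h₁ := sum_disjInd_mul_square (G := G)
  have h₂ : ∑ d : G.Dart, ∑ e : G.Dart,
      disjInd d e * (adjInd G d.fst e.snd * adjInd G d.snd e.fst) =
        8 * numSubgraphs G (cycleGraph 4) := by
    rw [← h₁, ← sum_sum_symm_right]
    simp only [disjInd_symm_right]
    rfl
  have hsq : ∀ x y, adjInd G x y ^ 2 = adjInd G x y := fun x y => by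
    simp [adjInd]
  have hpt : ∀ d e : G.Dart, disjInd d e * links d e ^ 2 = disjInd d e * links d e +
      2 * (disjInd d e * (adjInd G d.fst e.fst * adjInd G d.snd e.snd)) +
      2 * (disjInd d e * (adjInd G d.fst e.snd * adjInd G d.snd e.fst)) := by
    intro d e
    have t₁ := adjInd_mul_adjInd_of_triangleFree htri d.fst e
    have t₂ := adjInd_mul_adjInd_of_triangleFree htri d.snd e
    have t₃ := adjInd_mul_adjInd_of_triangleFree htri e.fst d
    have t₄ := adjInd_mul_adjInd_of_triangleFree htri e.snd d
    rw [adjInd_comm, adjInd_comm e.fst] at t₃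
    rw [adjInd_comm, adjInd_comm e.snd] at t₄
    have s₁ := hsq d.fst e.fst
    have s₂ := hsq d.fst e.snd
    have s₃ := hsq d.snd e.fst
    have s₄ := hsq d.snd e.snd
    simp only [links]
    linear_combination disjInd d e * (s₁ + s₂ + s₃ + s₄ + 2 * t₁ + 2 * t₂ + 2 * t₃ + 2 * t₄)
  simp only [hpt, Finset.sum_add_distrib, ← Finset.mul_sum, h₁, h₂,
    sum_disjInd_mul_links hreg htri]
  ring

end DartSums

theorem not_adj_of_adj_adj_of_colorable_two {V : Type*} {G : SimpleGraph V} (hG : G.Colorable 2)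
    (x y z : V) (hxy : G.Adj x y) (hyz : G.Adj y z) : ¬ G.Adj x z := by
  obtain ⟨c⟩ := hG
  intro hxz
  have h₁ := c.valid hxy
  have h₂ := c.valid hyz
  have h₃ := c.valid hxz
  omega

theorem stmt_13 {V : Type*} [Fintype V] [DecidableEq V] (G : SimpleGraph V) [DecidableRel G.Adj]
    (hreg : G.IsRegularOfDegree 3) (hbip : G.Colorable 2) (h : ℕ)
    (hcard : Fintype.card V = 2 * h + 8)
    (hsix : numSubgraphs G (cycleGraph 4) = 6)
    (hshare : ∀ H₁ H₂ : G.Subgraph, Nonempty (H₁.coe ≃g cycleGraph 4) →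
      Nonempty (H₂.coe ≃g cycleGraph 4) → H₁ ≠ H₂ →
      (H₁.edgeSet ∩ H₂.edgeSet).ncard ≤ 1) :
    8 * numMatchings G 4 = 27 * h ^ 4 + 162 * h ^ 3 + 273 * h ^ 2 + 234 * h + 72 := by
  have htri := not_adj_of_adj_adj_of_colorable_two hbip
  have hdart : (Fintype.card G.Dart : ℤ) = 6 * h + 24 := by
    have hsum := sum_dart_fst hreg fun _ => 1
    simp only [Finset.sum_const, Finset.card_univ, nsmul_eq_mul, mul_one, hcard] at hsum
    rw [hsum]
    push_cast
    ring
  have hmain := card_dartMatchings_four_eq hreg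
  rw [card_dartMatchings, sum_disjInd_mul_links hreg htri, sum_disjInd_mul_links_sq hreg htri,
    hsix, hdart, show Nat.factorial 4 = 24 from rfl] at hmain
  push_cast at hmain
  zify
  linarith
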